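/- (Macaulay–Buchberger Basis Theorem over rings) Let A be a commutative ring, 𝔞 ⊆ A[x₁,…,xₙ] a nonzero ideal, and G = {g₁,…,g_t} a monic Gröbner basis of 𝔞 with respect to a monomial order ≺. Then the set S = {x^α + 𝔞 : lm(gᵢ) ∤ x^α for i = 1,…,t} of residue classes of the standard monomials is an A-module basis of A[x₁,…,xₙ]/𝔞. -/

import Mathlib

open MvPolynomial

namespace GB

variable {σ A : Type*} [CommRing A]

/-- Leading monomial (exponent vector) of `f` w.r.t. the monomial order `m`. -/
noncomputable def lm (m : MonomialOrder σ) (f : MvPolynomial σ A) : σ →₀ ℕ :=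
  m.toSyn.symm (f.support.sup fun α => m.toSyn α)

/-- Leading coefficient of `f` w.r.t. `m`. -/
noncomputable def lc (m : MonomialOrder σ) (f : MvPolynomial σ A) : A :=
  f.coeff (lm m f)

/-- Leading term of `f` w.r.t. `m`. -/
noncomputable def lt (m : MonomialOrder σ) (f : MvPolynomial σ A) : MvPolynomial σ A :=
  monomial (lm m f) (lc m f)

/-- `G` is a Gröbner basis of the ideal `I` w.r.t. the monomial order `m`:
`G ⊆ I` and `⟨lt f : f ∈ I, f ≠ 0⟩ = ⟨lt g : g ∈ G⟩`. -/
def IsGrobnerBasis (m : MonomialOrder σ) (I : Ideal (MvPolynomial σ A))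
    (G : Finset (MvPolynomial σ A)) : Prop :=
  (G : Set (MvPolynomial σ A)) ⊆ I ∧
    Ideal.span (lt m '' {f : MvPolynomial σ A | f ∈ I ∧ f ≠ 0}) =
      Ideal.span (lt m '' (G : Set (MvPolynomial σ A)))

/-- `G` is monic: every element has leading coefficient `1`. -/
def IsMonic (m : MonomialOrder σ) (G : Finset (MvPolynomial σ A)) : Prop :=
  ∀ g ∈ G, lc m g = 1

/-- The border of an order ideal `O` of monomials:
`∂O = (x₁·O ∪ ⋯ ∪ xₙ·O) \ O`. -/
def border {n : ℕ} (O : Set (Fin n →₀ ℕ)) : Set (Fin n →₀ ℕ) :=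
  (⋃ i : Fin n, (fun α => α + Finsupp.single i 1) '' O) \ O

end GB

namespace GB

variable {σ A : Type*} [CommRing A] (m : MonomialOrder σ) {I : Ideal (MvPolynomial σ A)}
  {G : Finset (MvPolynomial σ A)}

/-- The leading monomial of a nonzero element of `I` is divisible by that of some `g ∈ G`. -/
theorem IsGrobnerBasis.exists_lm_le (hG : IsGrobnerBasis m I G) (hmonic : IsMonic m G)
    {f : MvPolynomial σ A} (hf : f ∈ I) (hf0 : f ≠ 0) : ∃ g ∈ G, lm m g ≤ lm m f := by
  have hlt : lt m '' (G : Set (MvPolynomial σ A)) =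
      (fun s => monomial s (1 : A)) '' (lm m '' (G : Set (MvPolynomial σ A))) := by
    rw [Set.image_image]
    exact Set.image_congr fun g hg => by rw [lt, hmonic g hg]
  have hmem : lt m f ∈ Ideal.span (lt m '' (G : Set (MvPolynomial σ A))) :=
    hG.2 ▸ Ideal.subset_span ⟨f, ⟨hf, hf0⟩, rfl⟩
  rw [hlt, mem_ideal_span_monomial_image] at hmem
  have hlc : lc m f ≠ 0 := m.leadingCoeff_ne_zero_iff.mpr hf0
  obtain ⟨_, ⟨g, hg, rfl⟩, hle⟩ := hmem (lm m f) (by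
    classical simpa [lt, coeff_monomial] using hlc)
  exact ⟨g, hg, hle⟩

/-- An element of `I` supported on standard monomials vanishes. -/
theorem IsGrobnerBasis.eq_zero_of_mem (hG : IsGrobnerBasis m I G) (hmonic : IsMonic m G)
    {f : MvPolynomial σ A} (hf : f ∈ I) (hstd : ∀ α ∈ f.support, ∀ g ∈ G, ¬ lm m g ≤ α) :
    f = 0 := by
  by_contra hf0
  obtain ⟨g, hg, hle⟩ := hG.exists_lm_le m hmonic hf hf0
  exact hstd _ (m.degree_mem_support hf0) g hg hle

/-- Modulo `I`, every polynomial agrees with one supported on standard monomials. -/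
theorem exists_sub_mem_of_isMonic (hGI : (G : Set (MvPolynomial σ A)) ⊆ I)
    (hmonic : IsMonic m G) (f : MvPolynomial σ A) :
    ∃ r : MvPolynomial σ A, f - r ∈ I ∧ ∀ α ∈ r.support, ∀ g ∈ G, ¬ lm m g ≤ α := by
  obtain ⟨q, r, hfr, -, hr⟩ := m.div_set (B := (G : Set (MvPolynomial σ A)))
    (fun g hg => by
      have hlc : m.leadingCoeff g = 1 := hmonic g hg
      exact hlc ▸ isUnit_one) f
  refine ⟨r, ?_, hr⟩
  rw [hfr, add_sub_cancel_right, Finsupp.linearCombination_apply]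
  exact I.sum_mem fun g _ => I.mul_mem_left _ (hGI g.2)

end GB

/-- Macaulay–Buchberger basis theorem over rings: the residue classes of the standard
monomials w.r.t. a monic Gröbner basis form an `A`-module basis of the quotient. -/
theorem macaulay_buchberger_basis
    {n : ℕ} {A : Type*} [CommRing A] (m : MonomialOrder (Fin n))
    (𝔞 : Ideal (MvPolynomial (Fin n) A)) (h𝔞 : 𝔞 ≠ ⊥)
    (G : Finset (MvPolynomial (Fin n) A))
    (hG : GB.IsGrobnerBasis m 𝔞 G) (hmonic : GB.IsMonic m G) :
    LinearIndependent A
      (fun α : {α : Fin n →₀ ℕ // ∀ g ∈ G, ¬ GB.lm m g ≤ α} =>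
        Ideal.Quotient.mk 𝔞 (monomial (α : Fin n →₀ ℕ) (1 : A))) ∧
    Submodule.span A
      (Set.range (fun α : {α : Fin n →₀ ℕ // ∀ g ∈ G, ¬ GB.lm m g ≤ α} =>
        Ideal.Quotient.mk 𝔞 (monomial (α : Fin n →₀ ℕ) (1 : A)))) = ⊤ := by
  constructor
  · have hli := ((basisMonomials (Fin n) A).linearIndependent.comp
      (Subtype.val : {α : Fin n →₀ ℕ // ∀ g ∈ G, ¬ GB.lm m g ≤ α} → _)
      Subtype.val_injective).map (f := (Ideal.Quotient.mkₐ A 𝔞).toLinearMap) (by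
        rw [Submodule.disjoint_def]
        intro f hf hker
        refine hG.eq_zero_of_mem m hmonic (Ideal.Quotient.eq_zero_iff_mem.mp hker) ?_
        have hle : Submodule.span A (Set.range ((basisMonomials (Fin n) A) ∘
            (Subtype.val : {α : Fin n →₀ ℕ // ∀ g ∈ G, ¬ GB.lm m g ≤ α} → _))) ≤
            restrictSupport A {α | ∀ g ∈ G, ¬ GB.lm m g ≤ α} := by
          rw [Submodule.span_le]
          rintro _ ⟨α, rfl⟩
          simp
        exact fun α hα => (mem_restrictSupport_iff A).mp (hle hf) hα)
    simpa [Function.comp_def] using hli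
  · rw [Submodule.eq_top_iff']
    intro x
    obtain ⟨f, rfl⟩ := Ideal.Quotient.mk_surjective x
    obtain ⟨r, hfr, hr⟩ := GB.exists_sub_mem_of_isMonic m hG.1 hmonic f
    rw [Ideal.Quotient.eq.mpr hfr, r.as_sum, map_sum]
    refine Submodule.sum_mem _ fun α hα => ?_
    have hmk : Ideal.Quotient.mk 𝔞 (monomial α (r.coeff α)) =
        r.coeff α • Ideal.Quotient.mk 𝔞 (monomial α (1 : A)) := by
      rw [← Ideal.Quotient.mkₐ_eq_mk A, ← map_smul, smul_monomial, smul_eq_mul, mul_one]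
    rw [hmk]
    exact Submodule.smul_mem _ _ (Submodule.subset_span ⟨⟨α, hr α hα⟩, rfl⟩)
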